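/- arXiv:1709.02577 — 5 statements merged into one kernel-verified Lean document; each statement's English description precedes it below -/
import Mathlib

section
/- The second moment of the smoothed function is controlled by the second moment of the original function: with c = sup_{v ∈ (0,1)^{d−1}} (Γ₂(v) − Γ₁(v)), one has ∫_{(0,1)^d} h̃(u)² du ≤ c · ∫_{(0,1)^d} h(u)² du. -/
open Set MeasureTheory

/-- Squaring and integrating the substituted function over the unit interval gives
`(b - a)` times the integral of the squared original over `(a, b)`. -/
lemma setIntegral_sq_affine_comp (φ : ℝ → ℝ) {a b : ℝ} (ha : 0 ≤ a) (hab : a ≤ b) (hb : b ≤ 1) :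
    ∫ x in Ioo (0:ℝ) 1, ((b - a) * φ (a + (b - a) * x)) ^ 2
      = (b - a) * ∫ x in Ioo (0:ℝ) 1, (if a < x ∧ x < b then φ x else 0) ^ 2 := by
  have hL : ∫ x in Ioo (0:ℝ) 1, ((b - a) * φ (a + (b - a) * x)) ^ 2
      = (b - a) * ∫ x in a..b, φ x ^ 2 := by
    have key := intervalIntegral.mul_integral_comp_add_mul (a := 0) (b := 1)
      (f := fun x => φ x ^ 2) (b - a) a
    rw [mul_zero, add_zero, mul_one, add_sub_cancel] at key
    rw [← integral_Ioc_eq_integral_Ioo, ← intervalIntegral.integral_of_le zero_le_one, ← key,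
      ← intervalIntegral.integral_const_mul, ← intervalIntegral.integral_const_mul]
    refine intervalIntegral.integral_congr fun x _ => ?_
    ring
  have hR : (fun x => (if a < x ∧ x < b then φ x else 0) ^ 2)
      = (Ioo a b).indicator fun x => φ x ^ 2 := by
    ext x
    by_cases h : a < x ∧ x < b <;> simp [indicator, h]
  rw [hL, hR, setIntegral_indicator measurableSet_Ioo,
    inter_eq_right.mpr (Ioo_subset_Ioo ha hb), intervalIntegral.integral_of_le hab,
    integral_Ioc_eq_integral_Ioo]

/-- Second-moment bound for the smoothed function:
with `c = sup_{v ∈ (0,1)^{d-1}} (Γ₂(v) − Γ₁(v))`, one has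
`∫ h̃² ≤ c · ∫ h²` over the unit cube.  Here `d = n + 1` and a point of
`(0,1)^d` is written as a pair `(u₁, u₂:d) : ℝ × (Fin n → ℝ)`. -/
theorem smoothed_second_moment
    (n m : ℕ) (hn : 1 ≤ n) (hm : 1 ≤ m)
    (Γ₁ Γ₂ : (Fin n → ℝ) → ℝ)
    (F : ℝ × (Fin n → ℝ) → (Fin m → ℝ)) (f : (Fin m → ℝ) → ℝ)
    (hΓ₁ : ContinuousOn Γ₁ {v : Fin n → ℝ | ∀ i, v i ∈ Ioo (0:ℝ) 1})
    (hΓ₂ : ContinuousOn Γ₂ {v : Fin n → ℝ | ∀ i, v i ∈ Ioo (0:ℝ) 1})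
    (hb : ∀ v ∈ {v : Fin n → ℝ | ∀ i, v i ∈ Ioo (0:ℝ) 1},
      0 ≤ Γ₁ v ∧ Γ₁ v ≤ Γ₂ v ∧ Γ₂ v ≤ 1)
    (hF : ContinuousOn F (Icc (0:ℝ) 1 ×ˢ {v : Fin n → ℝ | ∀ i, v i ∈ Icc (0:ℝ) 1}))
    (hf : Continuous f)
    (c : ℝ)
    (hc : c = sSup ((fun v => Γ₂ v - Γ₁ v) '' {v : Fin n → ℝ | ∀ i, v i ∈ Ioo (0:ℝ) 1})) :
    ∫ p in Ioo (0:ℝ) 1 ×ˢ {v : Fin n → ℝ | ∀ i, v i ∈ Ioo (0:ℝ) 1},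
        ((Γ₂ p.2 - Γ₁ p.2) * f (F (Γ₁ p.2 + (Γ₂ p.2 - Γ₁ p.2) * p.1, p.2)))^2
      ≤ c * ∫ p in Ioo (0:ℝ) 1 ×ˢ {v : Fin n → ℝ | ∀ i, v i ∈ Ioo (0:ℝ) 1},
        (if Γ₁ p.2 < p.1 ∧ p.1 < Γ₂ p.2 then f (F p) else 0)^2 := by
  set U : Set (Fin n → ℝ) := {v | ∀ i, v i ∈ Ioo (0:ℝ) 1} with hU
  set K : Set (Fin n → ℝ) := {v | ∀ i, v i ∈ Icc (0:ℝ) 1} with hK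
  have hUpi : U = Set.pi univ fun _ => Ioo (0:ℝ) 1 := by ext; simp [hU]
  have hKpi : K = Set.pi univ fun _ => Icc (0:ℝ) 1 := by ext; simp only [hK, mem_univ_pi, mem_ofPred_eq]
  have hUopen : IsOpen U := hUpi ▸ isOpen_set_pi finite_univ fun _ _ => isOpen_Ioo
  have hKcpt : IsCompact K := hKpi ▸ isCompact_univ_pi fun _ => isCompact_Icc
  have hUK : U ⊆ K := fun v hv i => Ioo_subset_Icc_self (hv i)
  set S : Set (ℝ × (Fin n → ℝ)) := Ioo (0:ℝ) 1 ×ˢ U with hS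
  have hSopen : IsOpen S := isOpen_Ioo.prod hUopen
  have hSQ : S ⊆ Icc (0:ℝ) 1 ×ˢ K := prod_mono Ioo_subset_Icc_self hUK
  have hSfin : volume S ≠ ⊤ :=
    ((measure_mono hSQ).trans_lt (isCompact_Icc.prod hKcpt).measure_lt_top).ne
  have hg : ContinuousOn (fun p => f (F p)) (Icc (0:ℝ) 1 ×ˢ K) := hf.comp_continuousOn hF
  obtain ⟨M, hM⟩ := (isCompact_Icc.prod hKcpt).exists_bound_of_continuousOn hg
  have hΓ₁S : ContinuousOn (fun p : ℝ × (Fin n → ℝ) => Γ₁ p.2) S :=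
    hΓ₁.comp continuousOn_snd fun p hp => hp.2
  have hΓ₂S : ContinuousOn (fun p : ℝ × (Fin n → ℝ) => Γ₂ p.2) S :=
    hΓ₂.comp continuousOn_snd fun p hp => hp.2
  have hmaps : MapsTo (fun p : ℝ × (Fin n → ℝ) => (Γ₁ p.2 + (Γ₂ p.2 - Γ₁ p.2) * p.1, p.2)) S
      (Icc (0:ℝ) 1 ×ˢ K) := by
    rintro ⟨x, v⟩ ⟨⟨hx0, hx1⟩, hv⟩
    obtain ⟨h0, h1, h2⟩ := hb v hv
    refine ⟨⟨?_, ?_⟩, hUK hv⟩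
    · exact add_nonneg h0 (mul_nonneg (sub_nonneg.2 h1) hx0.le)
    · have := mul_le_of_le_one_right (sub_nonneg.2 h1) hx1.le
      dsimp only
      linarith
  have hint₁ : IntegrableOn (fun p : ℝ × (Fin n → ℝ) =>
      ((Γ₂ p.2 - Γ₁ p.2) * f (F (Γ₁ p.2 + (Γ₂ p.2 - Γ₁ p.2) * p.1, p.2))) ^ 2) S := by
    have hcont : ContinuousOn (fun p : ℝ × (Fin n → ℝ) =>
        ((Γ₂ p.2 - Γ₁ p.2) * f (F (Γ₁ p.2 + (Γ₂ p.2 - Γ₁ p.2) * p.1, p.2))) ^ 2) S :=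
      ((hΓ₂S.sub hΓ₁S).mul (hg.comp ((hΓ₁S.add ((hΓ₂S.sub hΓ₁S).mul continuousOn_fst)).prodMk
        continuousOn_snd) hmaps)).pow 2
    refine IntegrableOn.of_bound hSfin.lt_top
      (hcont.aestronglyMeasurable hSopen.measurableSet) ((1 * M) ^ 2) ?_
    filter_upwards [ae_restrict_mem hSopen.measurableSet] with p hp
    obtain ⟨h0, h1, h2⟩ := hb p.2 hp.2
    rw [norm_pow, norm_mul]
    gcongr
    · rw [Real.norm_of_nonneg (sub_nonneg.2 h1)]
      linarith
    · exact hM _ (hmaps hp)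
  have hint₂ : IntegrableOn (fun p : ℝ × (Fin n → ℝ) =>
      (if Γ₁ p.2 < p.1 ∧ p.1 < Γ₂ p.2 then f (F p) else 0) ^ 2) S := by
    set D : Set (ℝ × (Fin n → ℝ)) := S ∩ {p | Γ₁ p.2 < p.1 ∧ p.1 < Γ₂ p.2} with hD
    have hDopen : IsOpen D := by
      have h := ((continuousOn_fst.sub hΓ₁S).prodMk (hΓ₂S.sub continuousOn_fst)
        ).isOpen_inter_preimage hSopen ((isOpen_Ioi (a := (0:ℝ))).prod (isOpen_Ioi (a := (0:ℝ))))
      convert h using 2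
      ext p
      simp
    have hDint : IntegrableOn (fun p => f (F p) ^ 2) D :=
      ((hg.pow 2).integrableOn_compact (isCompact_Icc.prod hKcpt)).mono_set
        (inter_subset_left.trans hSQ)
    refine (hDint.integrable_indicator hDopen.measurableSet).integrableOn.congr_fun
      (fun p hp => ?_) hSopen.measurableSet
    by_cases h : Γ₁ p.2 < p.1 ∧ p.1 < Γ₂ p.2 <;> simp [indicator, hD, hp, h]
  have hbdd : BddAbove ((fun v => Γ₂ v - Γ₁ v) '' U) := by
    refine ⟨1, ?_⟩
    rintro _ ⟨v, hv, rfl⟩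
    obtain ⟨h0, h1, h2⟩ := hb v hv
    dsimp only
    linarith
  have hvol : (volume : Measure (ℝ × (Fin n → ℝ))).restrict S
      = (volume.restrict (Ioo (0:ℝ) 1)).prod (volume.restrict U) := by
    rw [hS, Measure.prod_restrict, ← Measure.volume_eq_prod]
  rw [IntegrableOn, hvol] at hint₁ hint₂
  rw [hvol, integral_prod_symm _ hint₁, integral_prod_symm _ hint₂, ← integral_const_mul]
  refine integral_mono_ae hint₁.integral_prod_right (hint₂.integral_prod_right.const_mul c) ?_
  filter_upwards [ae_restrict_mem hUopen.measurableSet] with v hv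
  obtain ⟨h0, h1, h2⟩ := hb v hv
  rw [setIntegral_sq_affine_comp (fun x => f (F (x, v))) h0 h1 h2]
  refine mul_le_mul_of_nonneg_right ?_ (integral_nonneg fun x => sq_nonneg _)
  exact hc ▸ le_csSup hbdd (mem_image_of_mem _ hv)
end

section
/- Variance reduction of the variable push-out smoothing method: with c = sup_{v ∈ (0,1)^{d−1}} (Γ₂(v) − Γ₁(v)) ∈ [0,1], the variance of h̃(u) for u uniformly distributed on (0,1)^d satisfies Var(h̃(u)) ≤ c · Var(h(u)); in particular Var(h̃(u)) ≤ Var(h(u)). -/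
open Set MeasureTheory ProbabilityTheory

/-- The affine change of variables from `(0, 1)` onto `(a, b)`. -/
theorem integral_Ioo_ite_eq_mul {a b : ℝ} (ha : 0 ≤ a) (hab : a ≤ b) (hb : b ≤ 1) (g : ℝ → ℝ) :
    ∫ x in Ioo (0:ℝ) 1, (if a < x ∧ x < b then g x else 0) =
      (b - a) * ∫ x in Ioo (0:ℝ) 1, g (a + (b - a) * x) := by
  have hind : (fun x => if a < x ∧ x < b then g x else 0) = (Ioo a b).indicator g := by
    ext x
    simp [indicator_apply]
  rw [hind, setIntegral_indicator measurableSet_Ioo,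
    inter_eq_self_of_subset_right (Ioo_subset_Ioo ha hb), ← integral_Ioc_eq_integral_Ioo,
    ← integral_Ioc_eq_integral_Ioo, ← intervalIntegral.integral_of_le hab,
    ← intervalIntegral.integral_of_le zero_le_one, ← smul_eq_mul,
    intervalIntegral.smul_integral_comp_add_mul]
  simp

theorem variance_smoothed_le {α : Type*} [MeasurableSpace α] {ν : Measure α}
    [IsProbabilityMeasure ν] {a b : α → ℝ} {g : ℝ × α → ℝ} {c : ℝ} (hc : c ≤ 1)
    (hab : ∀ᵐ v ∂ν, 0 ≤ a v ∧ a v ≤ b v ∧ b v ≤ 1 ∧ b v - a v ≤ c)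
    (hs : MemLp (fun p : ℝ × α => (b p.2 - a p.2) * g (a p.2 + (b p.2 - a p.2) * p.1, p.2)) 2
      ((volume.restrict (Ioo (0:ℝ) 1)).prod ν))
    (hh : MemLp (fun p : ℝ × α => if a p.2 < p.1 ∧ p.1 < b p.2 then g p else 0) 2
      ((volume.restrict (Ioo (0:ℝ) 1)).prod ν)) :
    variance (fun p : ℝ × α => (b p.2 - a p.2) * g (a p.2 + (b p.2 - a p.2) * p.1, p.2))
        ((volume.restrict (Ioo (0:ℝ) 1)).prod ν) ≤
      c * variance (fun p : ℝ × α => if a p.2 < p.1 ∧ p.1 < b p.2 then g p else 0)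
        ((volume.restrict (Ioo (0:ℝ) 1)).prod ν) := by
  have : IsProbabilityMeasure (volume.restrict (Ioo (0:ℝ) 1)) := ⟨by simp⟩
  set μ := (volume.restrict (Ioo (0:ℝ) 1)).prod ν
  set s := fun p : ℝ × α => (b p.2 - a p.2) * g (a p.2 + (b p.2 - a p.2) * p.1, p.2) with hs_def
  set h := fun p : ℝ × α => if a p.2 < p.1 ∧ p.1 < b p.2 then g p else 0 with hh_def
  have hmean : ∫ p, s p ∂μ = ∫ p, h p ∂μ := by
    rw [integral_prod_symm _ (hs.integrable one_le_two),
      integral_prod_symm _ (hh.integrable one_le_two)]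
    refine integral_congr_ae ?_
    filter_upwards [hab] with v ⟨h0, h1, h2, _⟩
    simp only [hs_def, hh_def]
    rw [integral_Ioo_ite_eq_mul h0 h1 h2 (fun x => g (x, v)), integral_const_mul]
  have hsq : ∫ p, s p ^ 2 ∂μ ≤ c * ∫ p, h p ^ 2 ∂μ := by
    rw [integral_prod_symm _ hs.integrable_sq, integral_prod_symm _ hh.integrable_sq,
      ← integral_const_mul]
    refine integral_mono_ae hs.integrable_sq.integral_prod_right
      (hh.integrable_sq.integral_prod_right.const_mul c) ?_
    filter_upwards [hab] with v ⟨h0, h1, h2, h3⟩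
    have hcond : ∫ x in Ioo (0:ℝ) 1, s (x, v) ^ 2 =
        (b v - a v) * ∫ x in Ioo (0:ℝ) 1, h (x, v) ^ 2 := by
      simp only [hs_def, hh_def, ite_pow, mul_pow, ne_eq, OfNat.ofNat_ne_zero, not_false_eq_true,
        zero_pow]
      rw [integral_Ioo_ite_eq_mul h0 h1 h2 (fun x => g (x, v) ^ 2), integral_const_mul]
      ring
    exact hcond.trans_le
      (mul_le_mul_of_nonneg_right h3 (integral_nonneg fun x => sq_nonneg _))
  rw [variance_eq_sub hs, variance_eq_sub hh, hmean]
  simp only [Pi.pow_apply]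
  nlinarith [mul_nonneg (sub_nonneg.2 hc) (sq_nonneg (∫ p, h p ∂μ))]

/-- The truncated and smoothed integrands of a function `g` continuous on a closed cylinder are
bounded and measurable on the open cylinder. -/
theorem memLp_truncated_and_smoothed {E : Type*} [TopologicalSpace E] [MeasurableSpace E]
    [OpensMeasurableSpace (ℝ × E)]
    {ν : Measure (ℝ × E)} {Q K : Set E} [IsFiniteMeasure (ν.restrict (Ioo (0:ℝ) 1 ×ˢ Q))]
    (hQ : IsOpen Q) (hK : IsCompact K) (hQK : Q ⊆ K) {a b : E → ℝ} {g : ℝ × E → ℝ}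
    (ha : ContinuousOn a Q) (hb : ContinuousOn b Q)
    (hab : ∀ v ∈ Q, 0 ≤ a v ∧ a v ≤ b v ∧ b v ≤ 1)
    (hg : ContinuousOn g (Icc (0:ℝ) 1 ×ˢ K)) :
    MemLp (fun p : ℝ × E => (b p.2 - a p.2) * g (a p.2 + (b p.2 - a p.2) * p.1, p.2)) 2
      (ν.restrict (Ioo (0:ℝ) 1 ×ˢ Q)) ∧
    MemLp (fun p : ℝ × E => if a p.2 < p.1 ∧ p.1 < b p.2 then g p else 0) 2
      (ν.restrict (Ioo (0:ℝ) 1 ×ˢ Q)) := by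
  obtain ⟨M, hM⟩ := (isCompact_Icc.prod hK).exists_bound_of_continuousOn hg
  have hS : IsOpen (Ioo (0:ℝ) 1 ×ˢ Q) := isOpen_Ioo.prod hQ
  have hSK : Ioo (0:ℝ) 1 ×ˢ Q ⊆ Icc (0:ℝ) 1 ×ˢ K := prod_mono Ioo_subset_Icc_self hQK
  have ha' : ContinuousOn (fun p : ℝ × E => a p.2) (Ioo (0:ℝ) 1 ×ˢ Q) :=
    ha.comp continuousOn_snd fun p hp => hp.2
  have hb' : ContinuousOn (fun p : ℝ × E => b p.2) (Ioo (0:ℝ) 1 ×ˢ Q) :=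
    hb.comp continuousOn_snd fun p hp => hp.2
  have hmaps : MapsTo (fun p : ℝ × E => (a p.2 + (b p.2 - a p.2) * p.1, p.2))
      (Ioo (0:ℝ) 1 ×ˢ Q) (Icc (0:ℝ) 1 ×ˢ K) := by
    rintro ⟨x, v⟩ ⟨⟨hx0, hx1⟩, hv⟩
    obtain ⟨h0, h1, h2⟩ := hab v hv
    refine ⟨⟨?_, ?_⟩, hQK hv⟩ <;> dsimp only at * <;> nlinarith
  constructor
  · refine MemLp.of_bound (ContinuousOn.aestronglyMeasurable ?_ hS.measurableSet) M ?_
    · exact (hb'.sub ha').mul (hg.comp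
        ((ha'.add ((hb'.sub ha').mul continuousOn_fst)).prodMk continuousOn_snd) hmaps)
    · filter_upwards [ae_restrict_mem hS.measurableSet] with p hp
      obtain ⟨h0, h1, h2⟩ := hab p.2 hp.2
      rw [norm_mul, Real.norm_of_nonneg (sub_nonneg.2 h1)]
      exact (mul_le_of_le_one_left (norm_nonneg _) (by linarith)).trans (hM _ (hmaps hp))
  · have hU : IsOpen ((Ioo (0:ℝ) 1 ×ˢ Q) ∩ (fun p : ℝ × E => (p.1 - a p.2, b p.2 - p.1)) ⁻¹'
        (Ioi 0 ×ˢ Ioi 0)) :=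
      ((continuousOn_fst.sub ha').prodMk (hb'.sub continuousOn_fst)).isOpen_inter_preimage hS
        (isOpen_Ioi.prod isOpen_Ioi)
    refine MemLp.of_bound (((hg.mono hSK).aestronglyMeasurable hS.measurableSet).indicator
      hU.measurableSet |>.congr ?_) M ?_
    · filter_upwards [ae_restrict_mem hS.measurableSet] with p hp
      classical
      simp only [indicator_apply, mem_inter_iff, hp, true_and, mem_preimage, mem_prod, mem_Ioi,
        sub_pos]
    · filter_upwards [ae_restrict_mem hS.measurableSet] with p hp
      have := hM p (hSK hp)
      split_ifs
      · exact this
      · simpa using (norm_nonneg _).trans this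

/-- Variance reduction of the variable push-out smoothing method (Theorem 1(3)):
with `c = sup_{v ∈ (0,1)^{d-1}} (Γ₂(v) − Γ₁(v)) ∈ [0,1]`, for `u` uniform on the
unit cube (Lebesgue measure restricted to the cube, which has total mass 1),
`Var(h̃) ≤ c · Var(h)` and in particular `Var(h̃) ≤ Var(h)`.
Here `d = n + 1` and a point of `(0,1)^d` is written as a pair
`(u₁, u₂:d) : ℝ × (Fin n → ℝ)`. -/
theorem smoothed_variance_reduction
    (n m : ℕ) (hn : 1 ≤ n) (hm : 1 ≤ m)
    (Γ₁ Γ₂ : (Fin n → ℝ) → ℝ)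
    (F : ℝ × (Fin n → ℝ) → (Fin m → ℝ)) (f : (Fin m → ℝ) → ℝ)
    (hΓ₁ : ContinuousOn Γ₁ {v : Fin n → ℝ | ∀ i, v i ∈ Ioo (0:ℝ) 1})
    (hΓ₂ : ContinuousOn Γ₂ {v : Fin n → ℝ | ∀ i, v i ∈ Ioo (0:ℝ) 1})
    (hb : ∀ v ∈ {v : Fin n → ℝ | ∀ i, v i ∈ Ioo (0:ℝ) 1},
      0 ≤ Γ₁ v ∧ Γ₁ v ≤ Γ₂ v ∧ Γ₂ v ≤ 1)
    (hF : ContinuousOn F (Icc (0:ℝ) 1 ×ˢ {v : Fin n → ℝ | ∀ i, v i ∈ Icc (0:ℝ) 1}))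
    (hf : Continuous f)
    (c : ℝ)
    (hc : c = sSup ((fun v => Γ₂ v - Γ₁ v) '' {v : Fin n → ℝ | ∀ i, v i ∈ Ioo (0:ℝ) 1})) :
    variance
        (fun p : ℝ × (Fin n → ℝ) =>
          (Γ₂ p.2 - Γ₁ p.2) * f (F (Γ₁ p.2 + (Γ₂ p.2 - Γ₁ p.2) * p.1, p.2)))
        (volume.restrict (Ioo (0:ℝ) 1 ×ˢ {v : Fin n → ℝ | ∀ i, v i ∈ Ioo (0:ℝ) 1}))
      ≤ c * variance
        (fun p : ℝ × (Fin n → ℝ) =>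
          if Γ₁ p.2 < p.1 ∧ p.1 < Γ₂ p.2 then f (F p) else 0)
        (volume.restrict (Ioo (0:ℝ) 1 ×ˢ {v : Fin n → ℝ | ∀ i, v i ∈ Ioo (0:ℝ) 1}))
    ∧ variance
        (fun p : ℝ × (Fin n → ℝ) =>
          (Γ₂ p.2 - Γ₁ p.2) * f (F (Γ₁ p.2 + (Γ₂ p.2 - Γ₁ p.2) * p.1, p.2)))
        (volume.restrict (Ioo (0:ℝ) 1 ×ˢ {v : Fin n → ℝ | ∀ i, v i ∈ Ioo (0:ℝ) 1}))
      ≤ variance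
        (fun p : ℝ × (Fin n → ℝ) =>
          if Γ₁ p.2 < p.1 ∧ p.1 < Γ₂ p.2 then f (F p) else 0)
        (volume.restrict (Ioo (0:ℝ) 1 ×ˢ {v : Fin n → ℝ | ∀ i, v i ∈ Ioo (0:ℝ) 1})) := by
  set Q : Set (Fin n → ℝ) := {v | ∀ i, v i ∈ Ioo (0:ℝ) 1} with hQ_def
  set K : Set (Fin n → ℝ) := {v | ∀ i, v i ∈ Icc (0:ℝ) 1} with hK_def
  have hQ_pi : Q = univ.pi fun _ => Ioo (0:ℝ) 1 := by ext; simp only [hQ_def, mem_ofPred_eq, mem_univ_pi]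
  have hK_pi : K = univ.pi fun _ => Icc (0:ℝ) 1 := by ext; simp only [hK_def, mem_ofPred_eq, mem_univ_pi]
  have hQ : IsOpen Q := hQ_pi ▸ isOpen_set_pi finite_univ fun _ _ => isOpen_Ioo
  have hK : IsCompact K := hK_pi ▸ isCompact_univ_pi fun _ => isCompact_Icc
  have hQK : Q ⊆ K := fun v hv i => Ioo_subset_Icc_self (hv i)
  have hprob : IsProbabilityMeasure (volume.restrict Q) :=
    ⟨by rw [Measure.restrict_apply_univ, hQ_pi, volume_pi_pi]; simp⟩
  have hprob' : IsProbabilityMeasure (volume.restrict (Ioo (0:ℝ) 1)) := ⟨by simp⟩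
  have hμ : (volume : Measure (ℝ × (Fin n → ℝ))).restrict (Ioo (0:ℝ) 1 ×ˢ Q) =
      (volume.restrict (Ioo (0:ℝ) 1)).prod (volume.restrict Q) := by
    rw [Measure.prod_restrict, Measure.volume_eq_prod]
  have hle : ∀ v ∈ Q, Γ₂ v - Γ₁ v ≤ 1 := fun v hv => by
    obtain ⟨h0, -, h2⟩ := hb v hv
    linarith
  have hc1 : c ≤ 1 := hc ▸ Real.sSup_le (forall_mem_image.2 hle) zero_le_one
  have hlec : ∀ v ∈ Q, Γ₂ v - Γ₁ v ≤ c := fun v hv =>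
    hc ▸ le_csSup ⟨1, forall_mem_image.2 hle⟩ (mem_image_of_mem _ hv)
  have hfin : IsFiniteMeasure
      ((volume : Measure (ℝ × (Fin n → ℝ))).restrict (Ioo (0:ℝ) 1 ×ˢ Q)) := by
    rw [hμ]
    infer_instance
  obtain ⟨hs, hh⟩ := memLp_truncated_and_smoothed (ν := volume) hQ hK hQK hΓ₁ hΓ₂ hb
    (hf.comp_continuousOn hF)
  rw [hμ] at hs hh ⊢
  have hvar := variance_smoothed_le hc1 (by
    filter_upwards [ae_restrict_mem hQ.measurableSet] with v hv
    obtain ⟨h0, h1, h2⟩ := hb v hv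
    exact ⟨h0, h1, h2, hlec v hv⟩) hs hh
  exact ⟨hvar, hvar.trans (mul_le_of_le_one_left (variance_nonneg _ _) hc1)⟩
end

section
/- Smoothing for the complement region: define h_c(u) = f(F(u))·1{u₁ ≤ Γ₁(u_{2:d}) or u₁ ≥ Γ₂(u_{2:d})} and h̃_c(u) = f(F(u)) − (Γ₂(u_{2:d}) − Γ₁(u_{2:d}))·f(F(ũ)). Then h̃_c is continuous on (0,1)^d and ∫_{(0,1)^d} h̃_c(u) du = ∫_{(0,1)^d} h_c(u) du. -/
open Set MeasureTheory

/-- Rescaling an interval `[a, b] ⊆ [0, 1]` to `[0, 1]` and subtracting yields the integral over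
the complement of `[a, b]`. -/
theorem integral_sub_rescaled_eq_integral_complement {G : ℝ → ℝ} {a b : ℝ}
    (hG : ContinuousOn G (Icc 0 1)) (ha : 0 ≤ a) (hab : a ≤ b) (hb : b ≤ 1) :
    ∫ x in Ioo (0:ℝ) 1, (G x - (b - a) * G (a + (b - a) * x))
      = ∫ x in Ioo (0:ℝ) 1, (if x ≤ a ∨ b ≤ x then G x else 0) := by
  have hGi : IntegrableOn G (Ioo 0 1) := hG.integrableOn_Icc.mono_set Ioo_subset_Icc_self
  have hcomp : ContinuousOn (fun x => (b - a) * G (a + (b - a) * x)) (Icc 0 1) := by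
    refine continuousOn_const.mul (hG.comp (by fun_prop) fun x hx => ⟨?_, ?_⟩)
    · nlinarith [hx.1]
    · nlinarith [hx.2]
  have hcompi := hcomp.integrableOn_Icc (μ := volume) |>.mono_set Ioo_subset_Icc_self
  have hscale : ∫ x in Ioo (0:ℝ) 1, (b - a) * G (a + (b - a) * x) = ∫ x in Ioo a b, G x := by
    rw [← integral_Ioc_eq_integral_Ioo, ← integral_Ioc_eq_integral_Ioo,
      ← intervalIntegral.integral_of_le zero_le_one, ← intervalIntegral.integral_of_le hab,
      intervalIntegral.integral_const_mul]
    simp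
  have hsplit : ∀ x, (if x ≤ a ∨ b ≤ x then G x else 0) = G x - (Ioo a b).indicator G x := by
    intro x
    by_cases h : x ∈ Ioo a b
    · rw [indicator_of_mem h, if_neg (by rintro (h' | h') <;> linarith [h.1, h.2]), sub_self]
    · rw [indicator_of_notMem h, if_pos, sub_zero]
      by_contra! h'
      exact h h'
  simp_rw [hsplit]
  rw [integral_sub hGi hcompi, integral_sub hGi (hGi.indicator measurableSet_Ioo), hscale,
    setIntegral_indicator measurableSet_Ioo,
    inter_eq_self_of_subset_right (Ioo_subset_Ioo ha hb)]

/-- Smoothing for the complement region (Remark 1): with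
`h_c(u) = f(F(u))·1{u₁ ≤ Γ₁ ∨ u₁ ≥ Γ₂}` and
`h̃_c(u) = f(F(u)) − (Γ₂ − Γ₁)·f(F(ũ))`, the function `h̃_c` is continuous on
`(0,1)^d` and has the same integral over the unit cube as `h_c`.
Here `d = n + 1` and a point of `(0,1)^d` is written as a pair
`(u₁, u₂:d) : ℝ × (Fin n → ℝ)`. -/
theorem smoothed_complement
    (n m : ℕ) (hn : 1 ≤ n) (hm : 1 ≤ m)
    (Γ₁ Γ₂ : (Fin n → ℝ) → ℝ)
    (F : ℝ × (Fin n → ℝ) → (Fin m → ℝ)) (f : (Fin m → ℝ) → ℝ)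
    (hΓ₁ : ContinuousOn Γ₁ {v : Fin n → ℝ | ∀ i, v i ∈ Ioo (0:ℝ) 1})
    (hΓ₂ : ContinuousOn Γ₂ {v : Fin n → ℝ | ∀ i, v i ∈ Ioo (0:ℝ) 1})
    (hb : ∀ v ∈ {v : Fin n → ℝ | ∀ i, v i ∈ Ioo (0:ℝ) 1},
      0 ≤ Γ₁ v ∧ Γ₁ v ≤ Γ₂ v ∧ Γ₂ v ≤ 1)
    (hF : ContinuousOn F (Icc (0:ℝ) 1 ×ˢ {v : Fin n → ℝ | ∀ i, v i ∈ Icc (0:ℝ) 1}))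
    (hf : Continuous f) :
    ContinuousOn
      (fun p : ℝ × (Fin n → ℝ) =>
        f (F p) - (Γ₂ p.2 - Γ₁ p.2) * f (F (Γ₁ p.2 + (Γ₂ p.2 - Γ₁ p.2) * p.1, p.2)))
      (Ioo (0:ℝ) 1 ×ˢ {v : Fin n → ℝ | ∀ i, v i ∈ Ioo (0:ℝ) 1})
    ∧ ∫ p in Ioo (0:ℝ) 1 ×ˢ {v : Fin n → ℝ | ∀ i, v i ∈ Ioo (0:ℝ) 1},
        (f (F p) - (Γ₂ p.2 - Γ₁ p.2) * f (F (Γ₁ p.2 + (Γ₂ p.2 - Γ₁ p.2) * p.1, p.2)))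
      = ∫ p in Ioo (0:ℝ) 1 ×ˢ {v : Fin n → ℝ | ∀ i, v i ∈ Ioo (0:ℝ) 1},
        (if p.1 ≤ Γ₁ p.2 ∨ Γ₂ p.2 ≤ p.1 then f (F p) else 0) := by
  set B : Set (Fin n → ℝ) := {v | ∀ i, v i ∈ Ioo (0:ℝ) 1} with hB
  set K : Set (ℝ × (Fin n → ℝ)) := Icc (0:ℝ) 1 ×ˢ {v : Fin n → ℝ | ∀ i, v i ∈ Icc (0:ℝ) 1} with hK
  have hBm : MeasurableSet B := by
    simpa [hB, Set.pi] using MeasurableSet.univ_pi fun _ : Fin n => measurableSet_Ioo (a := (0:ℝ)) (b := 1)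
  have hSm : MeasurableSet (Ioo (0:ℝ) 1 ×ˢ B) := measurableSet_Ioo.prod hBm
  have hKc : IsCompact K := by
    simpa [hK, Set.pi] using isCompact_Icc.prod
      (isCompact_univ_pi fun _ : Fin n => isCompact_Icc (a := (0:ℝ)) (b := 1))
  have hSK : Ioo (0:ℝ) 1 ×ˢ B ⊆ K := fun p hp =>
    ⟨Ioo_subset_Icc_self hp.1, fun i => Ioo_subset_Icc_self (hp.2 i)⟩
  have hg : ContinuousOn (fun p => f (F p)) K := hf.comp_continuousOn hF
  have hΓ₁' : ContinuousOn (fun p : ℝ × (Fin n → ℝ) => Γ₁ p.2) (Ioo (0:ℝ) 1 ×ˢ B) :=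
    hΓ₁.comp continuousOn_snd fun p hp => hp.2
  have hΓ₂' : ContinuousOn (fun p : ℝ × (Fin n → ℝ) => Γ₂ p.2) (Ioo (0:ℝ) 1 ×ˢ B) :=
    hΓ₂.comp continuousOn_snd fun p hp => hp.2
  have hmaps : MapsTo (fun p : ℝ × (Fin n → ℝ) => (Γ₁ p.2 + (Γ₂ p.2 - Γ₁ p.2) * p.1, p.2))
      (Ioo (0:ℝ) 1 ×ˢ B) K := by
    intro p hp
    obtain ⟨h1, h2, h3⟩ := hb p.2 hp.2
    obtain ⟨h4, h5⟩ := hp.1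
    exact ⟨⟨by nlinarith, by nlinarith⟩, fun i => Ioo_subset_Icc_self (hp.2 i)⟩
  have hcomp : ContinuousOn (fun p : ℝ × (Fin n → ℝ) =>
      (Γ₂ p.2 - Γ₁ p.2) * f (F (Γ₁ p.2 + (Γ₂ p.2 - Γ₁ p.2) * p.1, p.2))) (Ioo (0:ℝ) 1 ×ˢ B) :=
    (hΓ₂'.sub hΓ₁').mul (hg.comp
      ((hΓ₁'.add ((hΓ₂'.sub hΓ₁').mul continuousOn_fst)).prodMk continuousOn_snd) hmaps)
  refine ⟨(hg.mono hSK).sub hcomp, ?_⟩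
  have hgi : IntegrableOn (fun p => f (F p)) (Ioo (0:ℝ) 1 ×ˢ B) :=
    (hg.integrableOn_compact hKc).mono_set hSK
  have hcompi : IntegrableOn (fun p : ℝ × (Fin n → ℝ) =>
      (Γ₂ p.2 - Γ₁ p.2) * f (F (Γ₁ p.2 + (Γ₂ p.2 - Γ₁ p.2) * p.1, p.2)))
      (Ioo (0:ℝ) 1 ×ˢ B) := by
    obtain ⟨C, hC⟩ := hKc.exists_bound_of_continuousOn hg
    refine IntegrableOn.of_bound
      ((measure_mono hSK).trans_lt hKc.measure_lt_top) (hcomp.aestronglyMeasurable hSm) C ?_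
    filter_upwards [ae_restrict_mem hSm] with p hp
    obtain ⟨h1, h2, h3⟩ := hb p.2 hp.2
    rw [norm_mul, Real.norm_of_nonneg (sub_nonneg.2 h2)]
    have := hC _ (hmaps hp)
    nlinarith [norm_nonneg (f (F (Γ₁ p.2 + (Γ₂ p.2 - Γ₁ p.2) * p.1, p.2)))]
  have hindi : IntegrableOn (fun p : ℝ × (Fin n → ℝ) =>
      if p.1 ≤ Γ₁ p.2 ∨ Γ₂ p.2 ≤ p.1 then f (F p) else 0) (Ioo (0:ℝ) 1 ×ˢ B) := by
    refine (Integrable.indicator₀ hgi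
      ((nullMeasurableSet_le measurable_fst.aemeasurable (hΓ₁'.aemeasurable hSm)).union
        (nullMeasurableSet_le (hΓ₂'.aemeasurable hSm) measurable_fst.aemeasurable))).congr
      (ae_of_all _ fun p => ?_)
    simp [indicator_apply]
  have hprod : (volume : Measure (ℝ × (Fin n → ℝ))).restrict (Ioo (0:ℝ) 1 ×ˢ B)
      = (volume.restrict (Ioo (0:ℝ) 1)).prod (volume.restrict B) := by
    rw [Measure.volume_eq_prod, Measure.prod_restrict]
  have hsubi := hgi.sub hcompi
  rw [IntegrableOn, hprod] at hindi hsubi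
  rw [hprod]
  rw [integral_prod_symm _ hindi]
  refine (integral_prod_symm _ hsubi).trans (setIntegral_congr_fun hBm fun v hv => ?_)
  obtain ⟨h1, h2, h3⟩ := hb v hv
  exact integral_sub_rescaled_eq_integral_complement (G := fun x => f (F (x, v)))
    (hg.comp (by fun_prop) fun x hx => ⟨hx, fun i => Ioo_subset_Icc_self (hv i)⟩) h1 h2 h3
end

section
/- Variable separation for the maximum (extreme function): for every u ∈ (0,1)^d and every κ > 0, one has max_{1≤j≤m} S_j < κ if and only if u₁ < min_{1≤j≤m} γ_j(u_{2:d}; κ). -/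
open Set

/-- Variable separation for the maximum (extreme function, Section 3.1):
`max_{1≤j≤m} S_j < κ` iff `u₁ < min_{1≤j≤m} γ_j(u₂:d; κ)`, where
`S_j = S₀·exp(φ⁻¹(u₁) + ⋯ + φ⁻¹(u_j))` and
`γ_j(u₂:d; κ) = φ(log(κ/S₀) − Σ_{i=2}^{j} φ⁻¹(u_i))`.
Here `ψ` denotes the inverse `φ⁻¹` of the increment CDF `φ : ℝ → (0,1)`. -/
theorem variable_separation_max
    (m : ℕ) (hm : 1 ≤ m) (S₀ : ℝ) (hS₀ : 0 < S₀)
    (φ ψ : ℝ → ℝ) (hmono : StrictMono φ) (hcont : Continuous φ)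
    (hrange : Set.range φ = Ioo (0:ℝ) 1)
    (hinv₁ : ∀ x, ψ (φ x) = x)
    (hinv₂ : ∀ y ∈ Ioo (0:ℝ) 1, φ (ψ y) = y)
    (u : ℕ → ℝ) (hu : ∀ i, 1 ≤ i → i ≤ m → u i ∈ Ioo (0:ℝ) 1)
    (κ : ℝ) (hκ : 0 < κ) :
    (Finset.Icc 1 m).sup' (Finset.nonempty_Icc.mpr hm)
        (fun j => S₀ * Real.exp (∑ i ∈ Finset.Icc 1 j, ψ (u i))) < κ ↔
      u 1 < (Finset.Icc 1 m).inf' (Finset.nonempty_Icc.mpr hm)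
        (fun j => φ (Real.log (κ / S₀) - ∑ i ∈ Finset.Icc 2 j, ψ (u i))) := by
  have hu₁ : u 1 ∈ Ioo (0:ℝ) 1 := hu 1 le_rfl hm
  rw [Finset.sup'_lt_iff, Finset.lt_inf'_iff]
  refine forall₂_congr fun j hj => ?_
  have hsplit : ∑ i ∈ Finset.Icc 1 j, ψ (u i) = ψ (u 1) + ∑ i ∈ Finset.Icc 2 j, ψ (u i) := by
    rw [← Finset.insert_Icc_add_one_left_eq_Icc (Finset.mem_Icc.mp hj).1,
      Finset.sum_insert (by simp), one_add_one_eq_two]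
  have hφ : u 1 < φ (Real.log (κ / S₀) - ∑ i ∈ Finset.Icc 2 j, ψ (u i)) ↔
      ψ (u 1) < Real.log (κ / S₀) - ∑ i ∈ Finset.Icc 2 j, ψ (u i) := by
    rw [← hmono.lt_iff_lt (a := ψ (u 1)), hinv₂ _ hu₁]
  rw [hφ, lt_sub_iff_add_lt, ← hsplit, Real.lt_log_iff_exp_lt (div_pos hκ hS₀), lt_div_iff₀' hS₀]
end

section
/- Variable separation for the down-and-out barrier payoff: with κ_j = κ for j = 1,…,m−1 and κ_m = max(K, κ), for every u ∈ (0,1)^d one has (S_m − K)·∏_{j=1}^m 1{S_j > κ_j} = (S_m − K)·1{u₁ > max_{1≤j≤m} γ_j(u_{2:d}; κ_j)}. -/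
open Set

/-- A price `S₀ · exp (ψ y + s)` exceeds a positive level `c` if and only if the variable `y`
exceeds the threshold `φ (log (c / S₀) - s)`. -/
theorem lt_mul_exp_add_iff_lt {φ ψ : ℝ → ℝ} (hmono : StrictMono φ) {S₀ c y : ℝ} (hS₀ : 0 < S₀)
    (hc : 0 < c) (hy : φ (ψ y) = y) (s : ℝ) :
    c < S₀ * Real.exp (ψ y + s) ↔ φ (Real.log (c / S₀) - s) < y := by
  rw [← div_lt_iff₀' hS₀, ← Real.log_lt_iff_lt_exp (div_pos hc hS₀), ← sub_lt_iff_lt_add]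
  conv_rhs => rw [← hy]
  exact hmono.lt_iff_lt.symm

/-- Variable separation for the down-and-out barrier payoff (equation (23)):
with `κ_j = κ` for `j < m` and `κ_m = max(K, κ)`,
`(S_m − K)·∏_{j=1}^m 1{S_j > κ_j} = (S_m − K)·1{u₁ > max_{1≤j≤m} γ_j(u₂:d; κ_j)}`,
where `S_j = S₀·exp(φ⁻¹(u₁) + ⋯ + φ⁻¹(u_j))` and
`γ_j(u₂:d; κ') = φ(log(κ'/S₀) − Σ_{i=2}^{j} φ⁻¹(u_i))`.
Here `ψ` denotes the inverse `φ⁻¹` of the increment CDF `φ : ℝ → (0,1)`. -/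
theorem variable_separation_barrier
    (m : ℕ) (hm : 1 ≤ m) (S₀ : ℝ) (hS₀ : 0 < S₀)
    (φ ψ : ℝ → ℝ) (hmono : StrictMono φ) (hcont : Continuous φ)
    (hrange : Set.range φ = Ioo (0:ℝ) 1)
    (hinv₁ : ∀ x, ψ (φ x) = x)
    (hinv₂ : ∀ y ∈ Ioo (0:ℝ) 1, φ (ψ y) = y)
    (u : ℕ → ℝ) (hu : ∀ i, 1 ≤ i → i ≤ m → u i ∈ Ioo (0:ℝ) 1)
    (K κ : ℝ) (hκ : 0 < κ) :
    (S₀ * Real.exp (∑ i ∈ Finset.Icc 1 m, ψ (u i)) - K) *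
        ∏ j ∈ Finset.Icc 1 m,
          (if S₀ * Real.exp (∑ i ∈ Finset.Icc 1 j, ψ (u i)) >
              (if j = m then max K κ else κ) then (1:ℝ) else 0)
      = (S₀ * Real.exp (∑ i ∈ Finset.Icc 1 m, ψ (u i)) - K) *
        (if u 1 > (Finset.Icc 1 m).sup' (Finset.nonempty_Icc.mpr hm)
            (fun j => φ (Real.log ((if j = m then max K κ else κ) / S₀) -
              ∑ i ∈ Finset.Icc 2 j, ψ (u i)))
          then (1:ℝ) else 0) := by
  have h_one : u 1 ∈ Ioo (0 : ℝ) 1 := hu 1 le_rfl hm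
  congr 1
  rw [Finset.prod_ite_zero, Finset.prod_const_one]
  refine if_congr ?_ rfl rfl
  simp only [gt_iff_lt, Finset.sup'_lt_iff]
  refine forall₂_congr fun j hj => ?_
  have hlevel : 0 < (if j = m then max K κ else κ) := by
    split_ifs
    exacts [lt_max_of_lt_right hκ, hκ]
  rw [← Finset.add_sum_Ioc_eq_sum_Icc (Finset.mem_Icc.mp hj).1]
  exact lt_mul_exp_add_iff_lt hmono hS₀ hlevel (hinv₂ _ h_one) _
end
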